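/- Suppose the single five-term relation T_{1,0} T_{0,1} = T_{0,1} T_{1,1} T_{1,0} holds in End_K(V)[[u,v]]. Then R(1,1) = [R(1,0), R(0,1)], where [A,B] = A∘B − B∘A. -/

import Mathlib

open Classical

/-- The generating series `T_{m,n} = Σ_{k≥0} u^{mk} v^{nk} R(mk,nk)` as a formal power
series in two commuting variables `u = X 0`, `v = X 1` with coefficients in `End_K V`:
its coefficient at the monomial `u^a v^b` is `R(a,b)` if `(a,b) = (mk,nk)` for some `k`,
and `0` otherwise (for coprime `(m,n)` this is exactly the displayed sum). -/
noncomputable def fiveTermT {K V : Type*} [Field K] [AddCommGroup V] [Module K V]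
    (R : ℕ × ℕ → Module.End K V) (m n : ℕ) :
    MvPowerSeries (Fin 2) (Module.End K V) :=
  fun d => if ∃ k : ℕ, d 0 = m * k ∧ d 1 = n * k then R (d 0, d 1) else 0

/-- The exponent of the monomial `u^a v^b`. -/
noncomputable def fiveTermPt (a b : ℕ) : Fin 2 →₀ ℕ :=
  Finsupp.single 0 a + Finsupp.single 1 b

lemma fiveTermPt_zero (a b : ℕ) : fiveTermPt a b 0 = a := by
  simp [fiveTermPt]

lemma fiveTermPt_one (a b : ℕ) : fiveTermPt a b 1 = b := by
  simp [fiveTermPt]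

lemma fiveTermPt_coeff_mul {A : Type*} [Semiring A] (f g : MvPowerSeries (Fin 2) A) (a b : ℕ) :
    MvPowerSeries.coeff (fiveTermPt a b) (f * g) =
      ∑ p ∈ Finset.HasAntidiagonal.antidiagonal a ×ˢ Finset.HasAntidiagonal.antidiagonal b,
        MvPowerSeries.coeff (fiveTermPt p.1.1 p.2.1) f *
          MvPowerSeries.coeff (fiveTermPt p.1.2 p.2.2) g := by
  rw [MvPowerSeries.coeff_mul]
  have key : ∀ d : Fin 2 →₀ ℕ, fiveTermPt (d 0) (d 1) = d := by
    intro d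
    ext i
    fin_cases i
    · exact fiveTermPt_zero _ _
    · exact fiveTermPt_one _ _
  refine Finset.sum_bij' (fun q _ => ((q.1 0, q.2 0), (q.1 1, q.2 1)))
    (fun p _ => (fiveTermPt p.1.1 p.2.1, fiveTermPt p.1.2 p.2.2)) ?_ ?_ ?_ ?_ ?_
  · intro q hq
    rw [Finset.HasAntidiagonal.mem_antidiagonal] at hq
    have h0 := DFunLike.congr_fun hq 0
    have h1 := DFunLike.congr_fun hq 1
    rw [fiveTermPt_zero] at h0
    rw [fiveTermPt_one] at h1
    simp only [Finset.mem_product, Finset.HasAntidiagonal.mem_antidiagonal]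
    exact ⟨h0, h1⟩
  · intro p hp
    simp only [Finset.mem_product, Finset.HasAntidiagonal.mem_antidiagonal] at hp ⊢
    rw [← hp.1, ← hp.2]
    simp only [fiveTermPt, Finsupp.single_add]
    abel
  · intro q _
    simp only [key]
  · intro p _
    simp only [fiveTermPt_zero, fiveTermPt_one]
  · intro q _
    simp only [key]

lemma fiveTermT_coeff {K V : Type*} [Field K] [AddCommGroup V] [Module K V]
    (R : ℕ × ℕ → Module.End K V) (m n a b : ℕ) :
    MvPowerSeries.coeff (fiveTermPt a b) (fiveTermT R m n) =
      if ∃ k : ℕ, a = m * k ∧ b = n * k then R (a, b) else 0 := by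
  change fiveTermT R m n (fiveTermPt a b) = _
  simp only [fiveTermT, fiveTermPt_zero, fiveTermPt_one]

theorem stmt_1 {K V : Type*} [Field K] [AddCommGroup V] [Module K V]
    (R : ℕ × ℕ → Module.End K V) (hR : R (0, 0) = LinearMap.id)
    (h5 : fiveTermT R 1 0 * fiveTermT R 0 1
        = fiveTermT R 0 1 * fiveTermT R 1 1 * fiveTermT R 1 0) :
    R (1, 1) = R (1, 0) ∘ₗ R (0, 1) - R (0, 1) ∘ₗ R (1, 0) := by
  have h := congrArg (MvPowerSeries.coeff (fiveTermPt 1 1)) h5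
  have a0 : Finset.HasAntidiagonal.antidiagonal 0 = {((0 : ℕ), (0 : ℕ))} := rfl
  have a1 : Finset.HasAntidiagonal.antidiagonal 1 = {((0 : ℕ), (1 : ℕ)), (1, 0)} := rfl
  have hR' : R (0, 0) = 1 := hR
  simp [fiveTermPt_coeff_mul, fiveTermT_coeff, a0, a1, Finset.sum_product, hR'] at h
  change R (1, 1) = R (1, 0) * R (0, 1) - R (0, 1) * R (1, 0)
  rw [h]
  abel
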